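/- Let d ≥ 3 and let m > n ≥ 1 be integers. Let U, V ⊆ ℤ^d be such that U ∪ V = B_m ∖ B_{n−1}, U contains the range of a path intersecting both ∂B_n and ∂B_m, and V contains the range of a path intersecting both ∂B_n and ∂B_m. Then there exists a *-path π = (π(1), …, π(|π|)) whose range intersects both ∂B_n and ∂B_m and such that for every 1 ≤ i ≤ |π| one has d(π(i), U) ≤ 1 and d(π(i), V) ≤ 1. -/

import Mathlib

/-- Nearest-neighbor adjacency on `ℤ^d`: Euclidean distance one. -/
def nnAdj {d : ℕ} (x y : Fin d → ℤ) : Prop := ∑ i, (x i - y i) ^ 2 = 1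

/-- `*`-adjacency on `ℤ^d`: sup-distance one. -/
def starAdj {d : ℕ} (x y : Fin d → ℤ) : Prop := x ≠ y ∧ ∀ i, |x i - y i| ≤ 1

/-- The box `B_r = ([-r,r] ∩ ℤ)^d`. -/
def latBox (d r : ℕ) : Set (Fin d → ℤ) := {x | ∀ i, |x i| ≤ (r : ℤ)}

/-- The inner boundary `∂B_r = {x ∈ B_r : |x|_∞ = r}`. -/
def latSphere (d r : ℕ) : Set (Fin d → ℤ) :=
  {x | (∀ i, |x i| ≤ (r : ℤ)) ∧ ∃ i, |x i| = (r : ℤ)}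

lemma exists_int_primitive {G : Type*} [AddCommGroup G] (f : ℤ → G) :
    ∃ F : ℤ → G, ∀ k, F (k + 1) = F k + f k := by
  refine ⟨fun k => ∑ j ∈ Finset.range k.toNat, f j
    - ∑ j ∈ Finset.range (-k).toNat, f (-(j : ℤ) - 1), fun k => ?_⟩
  rcases le_or_gt 0 k with hk | hk
  · obtain ⟨n, rfl⟩ := Int.eq_ofNat_of_zero_le hk
    have h1 : ((n : ℤ) + 1).toNat = n + 1 := by omega
    have h2 : (-((n : ℤ) + 1)).toNat = 0 := by omega
    have h3 : (-(n : ℤ)).toNat = 0 := by omega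
    simp only [h1, h2, h3, Int.toNat_natCast, Finset.sum_range_succ, Finset.sum_range_zero]
    abel
  · obtain ⟨n, rfl⟩ : ∃ n : ℕ, k = -(n : ℤ) - 1 := ⟨(-k - 1).toNat, by omega⟩
    have h1 : (-(n : ℤ) - 1 + 1).toNat = 0 := by omega
    have h2 : (-(-(n : ℤ) - 1 + 1)).toNat = n := by omega
    have h3 : (-(n : ℤ) - 1).toNat = 0 := by omega
    have h4 : (-(-(n : ℤ) - 1)).toNat = n + 1 := by omega
    simp only [h1, h2, h3, h4, Finset.sum_range_succ]
    abel

/-- A closed `1`-cochain on the cubical lattice is a coboundary. -/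
lemma exists_potential {ι G : Type*} [Fintype ι] [DecidableEq ι] [AddCommGroup G]
    (c : (ι → ℤ) → ι → G)
    (hc : ∀ x i j, c x i + c (x + Pi.single i 1) j = c x j + c (x + Pi.single j 1) i) :
    ∃ g : (ι → ℤ) → G, ∀ x i, g (x + Pi.single i 1) = g x + c x i := by
  suffices h : ∀ s : Finset ι, ∃ g : (ι → ℤ) → G, ∀ x, ∀ i ∈ s,
      g (x + Pi.single i 1) = g x + c x i by
    obtain ⟨g, hg⟩ := h Finset.univ
    exact ⟨g, fun x i => hg x i (Finset.mem_univ i)⟩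
  intro s
  induction s using Finset.induction_on with
  | empty => exact ⟨0, by simp⟩
  | insert i s hi ih =>
    obtain ⟨g, hg⟩ := ih
    choose F hF using exists_int_primitive (G := G)
    let r : (ι → ℤ) → G := fun x => c x i - (g (x + Pi.single i 1) - g x)
    have hr : ∀ x, ∀ j ∈ s, r (x + Pi.single j 1) = r x := by
      intro x j hj
      have h1 := hg (x + Pi.single i 1) j hj
      have h2 := hg x j hj
      have h3 := hc x i j
      simp only [r]
      rw [add_right_comm x, h1, h2, eq_sub_of_add_eq' h3.symm]
      abel
    refine ⟨fun x => g x + F (fun k => r (Function.update x i k)) (x i), fun x j hj => ?_⟩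
    rcases Finset.mem_insert.1 hj with rfl | hj
    · have h1 : ∀ k, Function.update (x + Pi.single j 1) j k = Function.update x j k := by
        intro k
        ext l
        by_cases h : l = j
        · subst h; simp
        · simp [h]
      simp only [h1, Pi.add_apply, Pi.single_eq_same, hF, Function.update_eq_self, r]
      abel
    · have hij : i ≠ j := fun h => hi (h ▸ hj)
      have h1 : ∀ k, Function.update (x + Pi.single j 1) i k
          = Function.update x i k + Pi.single j 1 := by
        intro k
        ext l
        by_cases h : l = i
        · subst h; simp [hij]
        · simp [h]
      simp only [h1, hr _ j hj, hg x j hj, Pi.add_apply, Pi.single_eq_of_ne hij, add_zero]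
      abel

lemma apply_update_eq_of_forall_step {ι α : Type*} [DecidableEq ι] (f : (ι → ℤ) → α)
    (x : ι → ℤ) (i : ι) (b : ℤ)
    (h : ∀ k, min (x i) b ≤ k → k < max (x i) b →
      f (Function.update x i (k + 1)) = f (Function.update x i k)) :
    f (Function.update x i b) = f x := by
  have key : ∀ p q : ℤ, p ≤ q → min (x i) b ≤ p → q ≤ max (x i) b →
      f (Function.update x i q) = f (Function.update x i p) := by
    intro p q hpq hp
    induction q, hpq using Int.leInduction with
    | base => exact fun _ => rfl
    | succ q hq ih => exact fun hq' => (h q (hp.trans hq) (by omega)).trans (ih (by omega))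
  rcases le_total (x i) b with hb | hb
  · simpa using key (x i) b hb (by simp) (by simp)
  · simpa using (key b (x i) hb (by simp) (by simp)).symm

lemma apply_piecewise_eq_of_forall_update {ι α : Type*} [DecidableEq ι] (f : (ι → ℤ) → α)
    (x y : ι → ℤ) (t : Finset ι)
    (h : ∀ z, (∀ i ∉ t, z i = x i) → (∀ i, z i = x i ∨ z i = y i) →
      ∀ i ∈ t, f (Function.update z i (y i)) = f z) :
    f (t.piecewise y x) = f x := by
  suffices H : ∀ s ⊆ t, f (s.piecewise y x) = f x from H t subset_rfl
  intro s
  induction s using Finset.induction_on with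
  | empty => simp
  | insert i s hi ih =>
    intro hs
    rw [Finset.insert_subset_iff] at hs
    rw [Finset.piecewise_insert, h _ _ _ i hs.1, ih hs.2]
    · exact fun j hj => Finset.piecewise_eq_of_notMem _ _ _ fun h => hj (hs.2 h)
    · intro j
      by_cases hj : j ∈ s <;> simp [hj]

lemma update_succ_eq_add_single {ι : Type*} [DecidableEq ι] (x : ι → ℤ) (i : ι) (k : ℤ) :
    Function.update x i (k + 1) = Function.update x i k + Pi.single i 1 := by
  ext l
  by_cases h : l = i
  · subst h; simp
  · simp [h]

/-- A function that is constant along the edges of a box is constant on the box. -/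
lemma eq_apply_zero_of_mem_box {ι α : Type*} [Fintype ι] [DecidableEq ι] (f : (ι → ℤ) → α)
    (r : ℤ) (h : ∀ x i, (∀ j, |x j| ≤ r) → (∀ j, |(x + Pi.single i 1 : ι → ℤ) j| ≤ r) →
      f (x + Pi.single i 1) = f x)
    (x : ι → ℤ) (hx : ∀ j, |x j| ≤ r) : f x = f 0 := by
  have H := apply_piecewise_eq_of_forall_update f x 0 Finset.univ ?_
  · simpa using H.symm
  intro z _ hz i _
  have hzr : ∀ j, |z j| ≤ r := by
    intro j
    have := hx j
    have := (abs_nonneg _).trans this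
    rcases hz j with h | h <;> simp [*]
  have hi := abs_le.1 (hzr i)
  refine apply_update_eq_of_forall_step f z i _ fun k h1 h2 => ?_
  simp only [Pi.zero_apply] at h1 h2
  have hup : ∀ a : ℤ, |a| ≤ r → ∀ j, |Function.update z i a j| ≤ r := by
    intro a ha j
    by_cases hj : j = i
    · subst hj; simpa using ha
    · simpa [hj] using hzr j
  rw [update_succ_eq_add_single]
  apply h
  · exact hup k (abs_le.2 (by omega))
  · rw [← update_succ_eq_add_single]
    exact hup (k + 1) (abs_le.2 (by omega))

/-- In dimension at least two, a function that is constant along the edges of the exterior of a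
box is constant on that exterior. -/
lemma eq_apply_const_of_mem_exterior {ι α : Type*} [Fintype ι] [DecidableEq ι] [Nontrivial ι]
    (f : (ι → ℤ) → α) (r : ℤ)
    (h : ∀ x i, (∃ j, r ≤ |x j|) → (∃ j, r ≤ |(x + Pi.single i 1 : ι → ℤ) j|) →
      f (x + Pi.single i 1) = f x)
    (x : ι → ℤ) (hx : ∃ j, r ≤ |x j|) : f x = f fun _ => r := by
  have move : ∀ (z : ι → ℤ) (i j : ι), j ≠ i → r ≤ |z j| →
      ∀ a, f (Function.update z i a) = f z := by
    intro z i j hji hj a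
    refine apply_update_eq_of_forall_step f z i a fun k _ _ => ?_
    rw [update_succ_eq_add_single]
    exact h _ _ ⟨j, by simpa [hji] using hj⟩ ⟨j, by simpa [hji] using hj⟩
  obtain ⟨i, hi⟩ := hx
  obtain ⟨j, hj⟩ := exists_ne i
  have H := apply_piecewise_eq_of_forall_update f x (fun _ => r) (Finset.univ.erase i) ?_
  · rw [← H, ← move _ i j hj (a := r)]
    · congr 1
      ext l
      by_cases hl : l = i
      · subst hl; simp
      · simp [hl]
    · simp [hj, le_abs_self]
  · intro z hz _ l hl
    exact move z l i (Finset.ne_of_mem_erase hl).symm (by rw [hz i (by simp)]; exact hi) _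

lemma apply_eq_of_isChain {β α : Type*} {R : β → β → Prop} (f : β → α) {S : Set β}
    (h : ∀ x ∈ S, ∀ y ∈ S, R x y → f x = f y) (l : List β) (hl : l.IsChain R)
    (hS : ∀ z ∈ l, z ∈ S) : ∀ x ∈ l, ∀ y ∈ l, f x = f y := by
  induction l with
  | nil => simp
  | cons a l ih =>
    have ih := ih hl.tail fun z hz => hS z (List.mem_cons_of_mem _ hz)
    have ha : ∀ x ∈ l, f a = f x := by
      cases l with
      | nil => simp
      | cons b l =>
        intro x hx
        rw [h a (hS _ (by simp)) b (hS _ (by simp)) (List.isChain_cons_cons.1 hl).1]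
        exact ih b (by simp) x hx
    intro x hx y hy
    rcases List.mem_cons.1 hx with rfl | hxl <;> rcases List.mem_cons.1 hy with rfl | hyl
    · rfl
    · exact ha y hyl
    · exact (ha x hxl).symm
    · exact ih x hxl y hyl

lemma eq_add_single_of_nnAdj {d : ℕ} {x y : Fin d → ℤ} (h : nnAdj x y) :
    ∃ i, y = x + Pi.single i 1 ∨ x = y + Pi.single i 1 := by
  unfold nnAdj at h
  obtain ⟨i, hi⟩ : ∃ i, x i - y i ≠ 0 := by
    by_contra! H
    simp [H] at h
  have hpos : 1 ≤ (x i - y i) ^ 2 := by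
    have := sq_pos_of_ne_zero hi
    omega
  rw [← Finset.add_sum_erase _ _ (Finset.mem_univ i)] at h
  have hnn : 0 ≤ ∑ j ∈ Finset.univ.erase i, (x j - y j) ^ 2 :=
    Finset.sum_nonneg fun _ _ => sq_nonneg _
  have h0 : ∑ j ∈ Finset.univ.erase i, (x j - y j) ^ 2 = 0 := by omega
  have h1 : (x i - y i) ^ 2 = 1 := by omega
  rw [Finset.sum_eq_zero_iff_of_nonneg fun _ _ => sq_nonneg _] at h0
  have hj : ∀ j, j ≠ i → x j = y j := fun j hj => by
    have := h0 j (by simp [hj])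
    have := pow_eq_zero_iff (two_ne_zero) |>.1 this
    omega
  refine ⟨i, ?_⟩
  rcases sq_eq_sq_iff_eq_or_eq_neg.1 (h1.trans (one_pow 2).symm) with h | h
  · right
    ext j
    by_cases hji : j = i
    · subst hji; simp; omega
    · simp [hji, hj j hji]
  · left
    ext j
    by_cases hji : j = i
    · subst hji; simp; omega
    · simp [hji, hj j hji]

/-- if `U ∪ V = B_m \ B_{n-1}` and both `U` and `V` contain a crossing from
`∂B_n` to `∂B_m`, then there is a `*`-path crossing `B_m \ B_{n-1}` staying within
`ℓ∞`-distance `1` of both `U` and `V`. -/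
theorem interface_crossing (d n m : ℕ) (hd : 3 ≤ d) (hn : 1 ≤ n) (hm : n < m)
    (U V : Set (Fin d → ℤ))
    (hUV : U ∪ V = latBox d m \ latBox d (n - 1))
    (hU : ∃ l : List (Fin d → ℤ), l.Chain' nnAdj ∧ (∀ z ∈ l, z ∈ U) ∧
      (∃ z ∈ l, z ∈ latSphere d n) ∧ (∃ z ∈ l, z ∈ latSphere d m))
    (hV : ∃ l : List (Fin d → ℤ), l.Chain' nnAdj ∧ (∀ z ∈ l, z ∈ V) ∧
      (∃ z ∈ l, z ∈ latSphere d n) ∧ (∃ z ∈ l, z ∈ latSphere d m)) :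
    ∃ π : List (Fin d → ℤ), π.Chain' starAdj ∧
      (∃ z ∈ π, z ∈ latSphere d n) ∧ (∃ z ∈ π, z ∈ latSphere d m) ∧
      ∀ z ∈ π, (∃ u ∈ U, ∀ i, |z i - u i| ≤ 1) ∧ (∃ v ∈ V, ∀ i, |z i - v i| ≤ 1) := by
  classical
  by_contra hno
  have hA : ∀ x, x ∈ U ∨ x ∈ V ↔ (∀ i, |x i| ≤ (m : ℤ)) ∧ ∃ i, (n : ℤ) ≤ |x i| := by
    intro x
    rw [← Set.mem_union, hUV]
    simp only [latBox, Set.mem_sdiff, Set.mem_ofPred_eq, not_forall, not_le]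
    refine and_congr_right fun _ => exists_congr fun i => ?_
    omega
  let W : Set (Fin d → ℤ) := {z | (z ∈ U ∨ z ∈ V) ∧
    (∃ u ∈ U, ∀ i, |z i - u i| ≤ 1) ∧ ∃ v ∈ V, ∀ i, |z i - v i| ≤ 1}
  let K : Set (Fin d → ℤ) := {x | ∃ l : List (Fin d → ℤ), (x :: l).IsChain starAdj ∧
    (∀ z ∈ x :: l, z ∈ W) ∧ ∃ z ∈ x :: l, z ∈ latSphere d n}
  have hKW : ∀ x ∈ K, x ∈ W := fun x ⟨l, _, h, _⟩ => h x (by simp)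
  have hWK : ∀ x ∈ W, x ∈ latSphere d n → x ∈ K := fun x hx hn =>
    ⟨[], by simp, by simpa using hx, x, by simp, hn⟩
  have hKm : ∀ x ∈ K, x ∉ latSphere d m := fun x ⟨l, h1, h2, h3⟩ hx =>
    hno ⟨x :: l, h1, h3, ⟨x, by simp, hx⟩, fun z hz => (h2 z hz).2⟩
  have hKstep : ∀ x ∈ K, ∀ y ∈ W, (∀ i, |y i - x i| ≤ 1) → y ∈ K := by
    rintro x ⟨l, h1, h2, z, hz, hzn⟩ y hy hxy
    by_cases h : y = x
    · exact h ▸ ⟨l, h1, h2, z, hz, hzn⟩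
    · refine ⟨x :: l, List.isChain_cons_cons.2 ⟨⟨h, hxy⟩, h1⟩, ?_,
        z, List.mem_cons_of_mem _ hz, hzn⟩
      intro w hw
      rcases List.mem_cons.1 hw with rfl | hw
      · exact hy
      · exact h2 w hw
  -- The region where the potential below follows the indicator of `U`.
  let P : Set (Fin d → ℤ) := {x | (∀ i, |x i| ≤ (n : ℤ)) ∨ x ∈ K}
  have hPA : ∀ x, (x ∈ U ∨ x ∈ V) → x ∈ W → x ∈ P → x ∈ K := by
    rintro x hx hW (h | h)
    · obtain ⟨-, i, hi⟩ := (hA x).1 hx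
      exact hWK x hW ⟨h, i, le_antisymm (h i) hi⟩
    · exact h
  have hPout : ∀ x, (∃ i, (m : ℤ) ≤ |x i|) → x ∉ P := by
    rintro x ⟨i, hi⟩ (h | h)
    · have := h i
      omega
    · have hx := ((hA x).1 (hKW x h).1).1
      exact hKm x h ⟨hx, i, le_antisymm (hx i) hi⟩
  have hT : ∀ Q : Set (Fin d → ℤ), (∀ x ∈ Q, ∀ y ∈ Q, ∀ i, |x i - y i| ≤ 1) →
      (∀ x ∈ Q, x ∈ P) ∨ (∀ x ∈ Q, x ∉ P) ∨ (∀ x ∈ Q, x ∈ U ∧ x ∉ V) ∨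
        (∀ x ∈ Q, x ∉ U) := by
    intro Q hQ
    have hnear : ∀ x ∈ Q, ∀ y ∈ Q, ∀ i, |x i| ≤ |y i| + 1 := fun x hx y hy i => by
      have h1 := hQ x hx y hy i
      have h2 := abs_sub_abs_le_abs_sub (x i) (y i)
      omega
    by_cases h1 : ∃ y ∈ Q, ∀ i, |y i| < (n : ℤ)
    · obtain ⟨y, hy, hyn⟩ := h1
      exact Or.inl fun x hx => Or.inl fun i => by
        have h1 := hnear x hx y hy i
        have h2 := hyn i
        omega
    by_cases h2 : ∃ y ∈ Q, ∃ i, (m : ℤ) < |y i|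
    · obtain ⟨y, hy, i, hi⟩ := h2
      refine Or.inr (Or.inl fun x hx => hPout x ⟨i, ?_⟩)
      have h1 := hnear y hy x hx i
      omega
    push Not at h1 h2
    have hQA : ∀ x ∈ Q, x ∈ U ∨ x ∈ V := fun x hx => (hA x).2 ⟨h2 x hx, h1 x hx⟩
    by_cases hu : ∃ u ∈ Q, u ∈ U
    swap
    · push Not at hu
      exact Or.inr (Or.inr (Or.inr hu))
    by_cases hv : ∃ v ∈ Q, v ∈ V
    swap
    · push Not at hv
      exact Or.inr (Or.inr (Or.inl fun x hx => ⟨(hQA x hx).resolve_right (hv x hx), hv x hx⟩))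
    obtain ⟨u, hu, huU⟩ := hu
    obtain ⟨v, hv, hvV⟩ := hv
    have hQW : ∀ x ∈ Q, x ∈ W := fun x hx =>
      ⟨hQA x hx, ⟨u, huU, hQ x hx u hu⟩, v, hvV, hQ x hx v hv⟩
    by_cases hk : ∃ x ∈ Q, x ∈ K
    · obtain ⟨x, hx, hxK⟩ := hk
      exact Or.inl fun y hy => Or.inr (hKstep x hxK y (hQW y hy) (hQ y hy x hx))
    · push Not at hk
      exact Or.inr (Or.inl fun x hx hxP => hk x hx (hPA x (hQA x hx) (hQW x hx) hxP))
  let χ : (Fin d → ℤ) → ZMod 2 := fun x => if x ∈ U then 1 else 0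
  let c : (Fin d → ℤ) → (Fin d → ℤ) → ZMod 2 := fun x y =>
    if x ∈ P ∧ y ∈ P then χ x + χ y else 0
  have htwo : ∀ a : ZMod 2, a + a = 0 := fun a => CharTwo.add_self_eq_zero a
  obtain ⟨g, hg⟩ := exists_potential (fun x i => c x (x + Pi.single i 1)) (by
    intro x i j
    by_cases hij : i = j
    · subst hij; rfl
    let Q : Set (Fin d → ℤ) := {y | ∀ l, x l ≤ y l ∧ y l ≤ x l + 1}
    have hsing : ∀ (i l : Fin d), (Pi.single i 1 : Fin d → ℤ) l = if l = i then 1 else 0 :=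
      fun i l => Pi.single_apply i 1 l
    have q1 : x ∈ Q := fun l => by omega
    have q2 : x + Pi.single i 1 ∈ Q := fun l => by
      rw [Pi.add_apply, hsing]; split_ifs <;> omega
    have q3 : x + Pi.single j 1 ∈ Q := fun l => by
      rw [Pi.add_apply, hsing]; split_ifs <;> omega
    have q4 : x + Pi.single i 1 + Pi.single j 1 ∈ Q := fun l => by
      rw [Pi.add_apply, Pi.add_apply, hsing, hsing]
      split_ifs with h1 h2
      · exact absurd (h1.symm.trans h2) hij
      all_goals omega
    rw [add_right_comm x (Pi.single j 1)]
    generalize x + Pi.single i 1 + Pi.single j 1 = w at *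
    generalize x + Pi.single i 1 = y at *
    generalize x + Pi.single j 1 = z at *
    rcases hT Q (fun x hx y hy l => by
      have h1 := hx l
      have h2 := hy l
      exact abs_le.2 (by omega)) with h | h | h | h
    · simp only [c, h _ q1, h _ q2, h _ q3, h _ q4, and_self, if_true]
      linear_combination htwo (χ y) - htwo (χ z)
    · simp [c, h _ q1, h _ q2, h _ q3]
    · simp [c, χ, h _ q1, h _ q2, h _ q3, h _ q4, htwo]
    · simp [c, χ, h _ q1, h _ q2, h _ q3, h _ q4])
  have hcsymm : ∀ x y, c x y = c y x := fun x y => by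
    simp only [c, and_comm, add_comm]
  have hgadj : ∀ x y, nnAdj x y → g x = g y + c x y ∧ ∀ i, |x i - y i| ≤ 1 := by
    intro x y hxy
    have hs : ∀ i l, |(Pi.single i 1 : Fin d → ℤ) l| ≤ 1 := fun i l => by
      rw [Pi.single_apply]; split_ifs <;> simp
    obtain ⟨i, rfl | rfl⟩ := eq_add_single_of_nnAdj hxy
    · refine ⟨?_, fun l => by simpa using hs i l⟩
      rw [hg]
      linear_combination -htwo (c x (x + Pi.single i 1))
    · refine ⟨?_, fun l => by simpa using hs i l⟩
      rw [hg, hcsymm]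
  have hpair : ∀ x y : Fin d → ℤ, (∀ i, |x i - y i| ≤ 1) →
      (x ∈ P ∧ y ∈ P) ∨ (x ∉ P ∧ y ∉ P) ∨ ((x ∈ U ∧ x ∉ V) ∧ (y ∈ U ∧ y ∉ V)) ∨
        (x ∉ U ∧ y ∉ U) := by
    intro x y hxy
    simpa using hT {x, y} (by
      rintro a (rfl | rfl) b (rfl | rfl) i
      · simp
      · exact hxy i
      · rw [abs_sub_comm]; exact hxy i
      · simp)
  have hUconst : ∀ x ∈ U, ∀ y ∈ U, nnAdj x y → g x = g y := by
    intro x hx y hy hxy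
    rw [(hgadj x y hxy).1]
    simp [c, χ, hx, hy, htwo]
  have hVconst : ∀ x ∈ V, ∀ y ∈ V, nnAdj x y →
      g x + (if x ∈ P then χ x else 0) = g y + (if y ∈ P then χ y else 0) := by
    intro x hx y hy hxy
    obtain ⟨h1, h2⟩ := hgadj x y hxy
    rw [h1]
    rcases hpair x y h2 with h | h | h | h
    · simp only [c, h.1, h.2, and_self, if_true]
      linear_combination htwo (χ x)
    · simp [c, h.1, h.2]
    · exact absurd hx h.1.2
    · simp [c, χ, h.1, h.2]
  have hin : ∀ x, (∀ i, |x i| ≤ (n : ℤ)) → g x + χ x = g 0 + χ 0 := by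
    refine eq_apply_zero_of_mem_box (fun x => g x + χ x) n fun x i h1 h2 => ?_
    have p1 : x ∈ P := Or.inl h1
    have p2 : x + Pi.single i 1 ∈ P := Or.inl h2
    simp only [hg, c, p1, p2, and_self, if_true]
    linear_combination htwo (χ (x + Pi.single i 1))
  have : Nontrivial (Fin d) := Fin.nontrivial_iff_two_le.2 (by omega)
  have hout : ∀ x, (∃ i, (m : ℤ) ≤ |x i|) → g x = g fun _ => (m : ℤ) := by
    refine eq_apply_const_of_mem_exterior g m fun x i h1 h2 => ?_
    simp [hg, c, hPout x h1]
  obtain ⟨l, hl, hlU, ⟨a, hal, han⟩, b, hbl, hbm⟩ := hU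
  obtain ⟨l', hl', hlV, ⟨a', hal', han'⟩, b', hbl', hbm'⟩ := hV
  have e1 := apply_eq_of_isChain g hUconst l hl hlU a hal b hbl
  have e2 := apply_eq_of_isChain _ hVconst l' hl' hlV a' hal' b' hbl'
  have hb := hout b ⟨_, hbm.2.choose_spec.ge⟩
  have hb' : ∃ i, (m : ℤ) ≤ |b' i| := ⟨_, hbm'.2.choose_spec.ge⟩
  have p1 : a' ∈ P := Or.inl han'.1
  have hχ : χ a = 1 := if_pos (hlU a hal)
  simp only [p1, hPout b' hb', if_true, if_false, add_zero] at e2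
  have : (1 : ZMod 2) = 0 := by
    linear_combination hin a han.1 - hin a' han'.1 - e1 + e2 - hb + hout b' hb' - hχ
  exact one_ne_zero this
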